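/- arXiv:2405.07252 — 2 statements merged into one kernel-verified Lean document; each statement's English description precedes it below -/
import Mathlib

section
/- (Theorem 1) The min-max regret of universal batch learning under the misspecification setting equals the maximum of J over priors: R*_N(Θ, Φ) = max over priors π on F of ( I_π(Y_N; Φ | Y^{N-1}) − Σ_φ π(φ) D_{c,N}(P_φ ‖ Θ) ). -/
noncomputable section

/-- A model: a strictly positive probability function on `Y^(n+1)`. -/
def IsModel {Y : Type*} [Fintype Y] {n : ℕ} (P : (Fin (n + 1) → Y) → ℝ) : Prop :=
  (∀ y, 0 < P y) ∧ (∑ y, P y) = 1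

/-- A predictor: to every prefix `y^{N-1}` it assigns a strictly positive
probability function on `Y`. -/
def IsPredictor {Y : Type*} [Fintype Y] {n : ℕ} (Q : (Fin n → Y) → Y → ℝ) : Prop :=
  ∀ z, (∀ y, 0 < Q z y) ∧ (∑ y, Q z y) = 1

/-- Marginal probability `P(y^{N-1}) = Σ_y P(y^{N-1}, y)` of a prefix. -/
def prefixProb {Y : Type*} [Fintype Y] {n : ℕ} (P : (Fin (n + 1) → Y) → ℝ)
    (z : Fin n → Y) : ℝ :=
  ∑ y : Y, P (Fin.snoc z y)

/-- Conditional probability `P(y_N | y^{N-1}) = P(y^N) / P(y^{N-1})`. -/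
def condProb {Y : Type*} [Fintype Y] {n : ℕ} (P : (Fin (n + 1) → Y) → ℝ)
    (y : Fin (n + 1) → Y) : ℝ :=
  P y / prefixProb P (Fin.init y)

/-- The regret
`R_N(Pφ, Pθ, Q) = Σ_{y^N} Pφ(y^N) log( Pθ(y_N|y^{N-1}) / Q(y_N|y^{N-1}) )`. -/
def regretN {Y : Type*} [Fintype Y] {n : ℕ} (Pφ Pθ : (Fin (n + 1) → Y) → ℝ)
    (Q : (Fin n → Y) → Y → ℝ) : ℝ :=
  ∑ y, Pφ y * Real.log (condProb Pθ y / Q (Fin.init y) (y (Fin.last n)))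

/-- Conditional KL divergence of a model `P` from a predictor `Q`. -/
def DcPred {Y : Type*} [Fintype Y] {n : ℕ} (P : (Fin (n + 1) → Y) → ℝ)
    (Q : (Fin n → Y) → Y → ℝ) : ℝ :=
  ∑ y, P y * Real.log (condProb P y / Q (Fin.init y) (y (Fin.last n)))

/-- Conditional KL divergence of a model `P` from another model `P'`. -/
def DcModel {Y : Type*} [Fintype Y] {n : ℕ} (P P' : (Fin (n + 1) → Y) → ℝ) : ℝ :=
  ∑ y, P y * Real.log (condProb P y / condProb P' y)

/-- A prior: a probability vector on the index set `F`. -/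
def IsPrior {F : Type*} [Fintype F] (π : F → ℝ) : Prop :=
  (∀ φ, 0 ≤ π φ) ∧ (∑ φ, π φ) = 1

/-- Conditional divergence of a model from the hypothesis class
`Θ = {P θ : θ ∈ G}`: the minimum over `θ ∈ G` of `D_{c,N}(P ‖ P θ)`. -/
def DcSet {Y F : Type*} [Fintype Y] [Fintype F] {n : ℕ}
    (P : F → (Fin (n + 1) → Y) → ℝ) (G : Finset F) (hG : G.Nonempty)
    (Pφ : (Fin (n + 1) → Y) → ℝ) : ℝ :=
  G.inf' hG fun θ => DcModel Pφ (P θ)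

/-- The mixture predictor
`Q_π(y_N | y^{N-1}) = (Σ_φ π(φ) P_φ(y^N)) / (Σ_φ π(φ) P_φ(y^{N-1}))`. -/
def mixPred {Y F : Type*} [Fintype Y] [Fintype F] {n : ℕ}
    (P : F → (Fin (n + 1) → Y) → ℝ) (π : F → ℝ) : (Fin n → Y) → Y → ℝ :=
  fun z y => (∑ φ, π φ * P φ (Fin.snoc z y)) / (∑ φ, π φ * prefixProb (P φ) z)

/-- `I_π(Y_N; Φ | Y^{N-1})`. -/
def mutualInfoN {Y F : Type*} [Fintype Y] [Fintype F] {n : ℕ}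
    (P : F → (Fin (n + 1) → Y) → ℝ) (π : F → ℝ) : ℝ :=
  ∑ φ, ∑ y, π φ * P φ y *
    Real.log (condProb (P φ) y / mixPred P π (Fin.init y) (y (Fin.last n)))

/-- `J(π) = I_π(Y_N; Φ | Y^{N-1}) − Σ_φ π(φ) D_{c,N}(P_φ ‖ Θ)`. -/
def Jfun {Y F : Type*} [Fintype Y] [Fintype F] {n : ℕ}
    (P : F → (Fin (n + 1) → Y) → ℝ) (G : Finset F) (hG : G.Nonempty)
    (π : F → ℝ) : ℝ :=
  mutualInfoN P π - ∑ φ, π φ * DcSet P G hG (P φ)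

/-- The min-max regret
`R*_N(Θ, Φ) = inf_Q max_{φ ∈ F} max_{θ ∈ G} R_N(P_φ, P_θ, Q)`. -/
def Rstar {Y F : Type*} [Fintype Y] [Fintype F] [Nonempty F] {n : ℕ}
    (P : F → (Fin (n + 1) → Y) → ℝ) (G : Finset F) (hG : G.Nonempty) : ℝ :=
  sInf {r : ℝ | ∃ Q, IsPredictor Q ∧
    r = Finset.univ.sup' Finset.univ_nonempty fun φ =>
          G.sup' hG fun θ => regretN (P φ) (P θ) Q}

/-- The conditional capacity `C_{c,N}(Φ) = sup_π I_π(Y_N; Φ | Y^{N-1})`. -/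
def capacityN {Y F : Type*} [Fintype Y] [Fintype F] {n : ℕ}
    (P : F → (Fin (n + 1) → Y) → ℝ) : ℝ :=
  sSup {r : ℝ | ∃ π, IsPrior π ∧ r = mutualInfoN P π}

/-- The binary entropy `h(λ) = −λ log λ − (1−λ) log(1−λ)`
(with `h(0) = h(1) = 0`, using `Real.log 0 = 0`). -/
def binEnt (l : ℝ) : ℝ := -(l * Real.log l) - (1 - l) * Real.log (1 - l)

section RegretCapacity

variable {Y F : Type*} [Fintype Y] [Fintype F] {n : ℕ}

theorem sum_eq_sum_snoc (f : (Fin (n + 1) → Y) → ℝ) :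
    ∑ y, f y = ∑ z : Fin n → Y, ∑ a : Y, f (Fin.snoc z a) := by
  rw [← (Fin.snocEquiv fun _ : Fin (n + 1) => Y).sum_comp, Fintype.sum_prod_type_right]
  rfl

theorem IsModel.nonempty {P : (Fin (n + 1) → Y) → ℝ} (hP : IsModel P) : Nonempty Y := by
  by_contra h
  rw [not_nonempty_iff] at h
  simpa using hP.2

theorem IsModel.prefixProb_pos {P : (Fin (n + 1) → Y) → ℝ} (hP : IsModel P) (z : Fin n → Y) :
    0 < prefixProb P z :=
  have := hP.nonempty
  Finset.sum_pos (fun _ _ => hP.1 _) Finset.univ_nonempty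

theorem IsModel.condProb_pos {P : (Fin (n + 1) → Y) → ℝ} (hP : IsModel P)
    (y : Fin (n + 1) → Y) : 0 < condProb P y :=
  div_pos (hP.1 y) (hP.prefixProb_pos _)

theorem IsPrior.sum_mul_pos {π : F → ℝ} (hπ : IsPrior π) {g : F → ℝ} (hg : ∀ φ, 0 < g φ) :
    0 < ∑ φ, π φ * g φ := by
  obtain ⟨φ, hφ⟩ : ∃ φ, π φ ≠ 0 := by
    by_contra! h
    simpa [h] using hπ.2
  exact Finset.sum_pos' (fun ψ _ => mul_nonneg (hπ.1 ψ) (hg ψ).le)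
    ⟨φ, Finset.mem_univ _, mul_pos ((hπ.1 φ).lt_of_ne' hφ) (hg φ)⟩

variable {P : F → (Fin (n + 1) → Y) → ℝ}

theorem IsPrior.mixPred_pos {π : F → ℝ} (hπ : IsPrior π) (hP : ∀ φ, IsModel (P φ))
    (z : Fin n → Y) (a : Y) : 0 < mixPred P π z a :=
  div_pos (hπ.sum_mul_pos fun φ => (hP φ).1 _) (hπ.sum_mul_pos fun φ => (hP φ).prefixProb_pos z)

theorem IsPrior.isPredictor_mixPred {π : F → ℝ} (hπ : IsPrior π) (hP : ∀ φ, IsModel (P φ)) :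
    IsPredictor (mixPred P π) := by
  refine fun z => ⟨hπ.mixPred_pos hP z, ?_⟩
  have h : ∑ a, ∑ φ, π φ * P φ (Fin.snoc z a) = ∑ φ, π φ * prefixProb (P φ) z := by
    rw [Finset.sum_comm]
    simp only [prefixProb, Finset.mul_sum]
  simp only [mixPred]
  rw [← Finset.sum_div, h, div_self (hπ.sum_mul_pos fun φ => (hP φ).prefixProb_pos z).ne']

theorem regretN_eq_sub {Pφ Pθ : (Fin (n + 1) → Y) → ℝ} (hφ : IsModel Pφ) (hθ : IsModel Pθ)
    {Q : (Fin n → Y) → Y → ℝ} (hQ : IsPredictor Q) :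
    regretN Pφ Pθ Q = DcPred Pφ Q - DcModel Pφ Pθ := by
  rw [regretN, DcPred, DcModel, ← Finset.sum_sub_distrib]
  refine Finset.sum_congr rfl fun y _ => ?_
  have h₁ := (hφ.condProb_pos y).ne'
  have h₂ := (hθ.condProb_pos y).ne'
  have h₃ := ((hQ (Fin.init y)).1 (y (Fin.last n))).ne'
  rw [Real.log_div h₂ h₃, Real.log_div h₁ h₃, Real.log_div h₁ h₂]
  ring

theorem sup'_regretN (hP : ∀ φ, IsModel (P φ)) (G : Finset F) (hG : G.Nonempty)
    {Q : (Fin n → Y) → Y → ℝ} (hQ : IsPredictor Q) (φ : F) :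
    (G.sup' hG fun θ => regretN (P φ) (P θ) Q) = DcPred (P φ) Q - DcSet P G hG (P φ) := by
  simp only [regretN_eq_sub (hP φ) (hP _) hQ]
  apply le_antisymm
  · exact Finset.sup'_le _ _ fun θ hθ =>
      sub_le_sub_left (Finset.inf'_le (fun θ => DcModel (P φ) (P θ)) hθ) _
  · obtain ⟨θ, hθ, h⟩ := G.exists_mem_eq_inf' hG fun θ => DcModel (P φ) (P θ)
    rw [DcSet, h]
    exact Finset.le_sup' (fun θ => DcPred (P φ) Q - DcModel (P φ) (P θ)) hθ

theorem Jfun_eq_sum (G : Finset F) (hG : G.Nonempty) (π : F → ℝ) :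
    Jfun P G hG π = ∑ φ, π φ * (DcPred (P φ) (mixPred P π) - DcSet P G hG (P φ)) := by
  simp only [Jfun, mutualInfoN, DcPred, mul_sub, Finset.sum_sub_distrib, Finset.mul_sum, mul_assoc]

/-- The mixture predictor minimizes the average conditional divergence. -/
theorem IsPrior.sum_DcPred_mixPred_le {π : F → ℝ} (hπ : IsPrior π) (hP : ∀ φ, IsModel (P φ))
    {Q : (Fin n → Y) → Y → ℝ} (hQ : IsPredictor Q) :
    ∑ φ, π φ * DcPred (P φ) (mixPred P π) ≤ ∑ φ, π φ * DcPred (P φ) Q := by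
  have hm (z : Fin n → Y) := hπ.sum_mul_pos fun φ => (hP φ).prefixProb_pos z
  have hM (y : Fin (n + 1) → Y) := hπ.sum_mul_pos fun φ => (hP φ).1 y
  have hdiff : ∑ φ, π φ * DcPred (P φ) Q - ∑ φ, π φ * DcPred (P φ) (mixPred P π) =
      ∑ y, (∑ φ, π φ * P φ y) * (Real.log (mixPred P π (Fin.init y) (y (Fin.last n))) -
        Real.log (Q (Fin.init y) (y (Fin.last n)))) := by
    simp only [DcPred, Finset.mul_sum, Finset.sum_mul]
    rw [← Finset.sum_sub_distrib, Finset.sum_comm]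
    refine Finset.sum_congr rfl fun φ _ => ?_
    rw [← Finset.sum_sub_distrib]
    refine Finset.sum_congr rfl fun y _ => ?_
    rw [Real.log_div ((hP φ).condProb_pos y).ne' ((hQ _).1 _).ne',
      Real.log_div ((hP φ).condProb_pos y).ne' (hπ.mixPred_pos hP _ _).ne']
    ring
  have hzero : ∑ y, ((∑ φ, π φ * P φ y) -
      (∑ φ, π φ * prefixProb (P φ) (Fin.init y)) * Q (Fin.init y) (y (Fin.last n))) = 0 := by
    rw [sum_eq_sum_snoc]
    refine Finset.sum_eq_zero fun z _ => ?_
    simp only [Fin.init_snoc, Fin.snoc_last]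
    rw [Finset.sum_sub_distrib, ← Finset.mul_sum, (hQ z).2, Finset.sum_comm]
    simp only [prefixProb, Finset.mul_sum, mul_one, sub_self]
  rw [← sub_nonneg, hdiff, ← hzero]
  refine Finset.sum_le_sum fun y _ => ?_
  have hmix := hπ.mixPred_pos hP (Fin.init y) (y (Fin.last n))
  have hq := (hQ (Fin.init y)).1 (y (Fin.last n))
  have hlog := Real.log_le_sub_one_of_pos (div_pos hq hmix)
  rw [Real.log_div hq.ne' hmix.ne'] at hlog
  have hval : (∑ φ, π φ * prefixProb (P φ) (Fin.init y)) * Q (Fin.init y) (y (Fin.last n)) =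
      (∑ φ, π φ * P φ y) * (Q (Fin.init y) (y (Fin.last n)) /
        mixPred P π (Fin.init y) (y (Fin.last n))) := by
    have h₁ := (hM y).ne'
    have h₂ := (hm (Fin.init y)).ne'
    simp only [mixPred, Fin.snoc_init_self]
    field_simp
  rw [hval]
  have := mul_le_mul_of_nonneg_left hlog (hM y).le
  linarith

theorem IsPrior.Jfun_le_sum {π : F → ℝ} (hπ : IsPrior π) (hP : ∀ φ, IsModel (P φ))
    (G : Finset F) (hG : G.Nonempty) {Q : (Fin n → Y) → Y → ℝ} (hQ : IsPredictor Q) :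
    Jfun P G hG π ≤ ∑ φ, π φ * (DcPred (P φ) Q - DcSet P G hG (P φ)) := by
  simp only [Jfun_eq_sum, mul_sub, Finset.sum_sub_distrib]
  exact sub_le_sub_right (hπ.sum_DcPred_mixPred_le hP hQ) _

theorem IsPrior.Jfun_le_sup' [Nonempty F] {π : F → ℝ} (hπ : IsPrior π) (hP : ∀ φ, IsModel (P φ))
    (G : Finset F) (hG : G.Nonempty) {Q : (Fin n → Y) → Y → ℝ} (hQ : IsPredictor Q) :
    Jfun P G hG π ≤ Finset.univ.sup' Finset.univ_nonempty fun φ =>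
      G.sup' hG fun θ => regretN (P φ) (P θ) Q := by
  refine (hπ.Jfun_le_sum hP G hG hQ).trans ?_
  simp only [sup'_regretN hP G hG hQ]
  set S := Finset.univ.sup' Finset.univ_nonempty fun φ => DcPred (P φ) Q - DcSet P G hG (P φ)
  calc ∑ φ, π φ * (DcPred (P φ) Q - DcSet P G hG (P φ)) ≤ ∑ φ, π φ * S :=
        Finset.sum_le_sum fun φ _ => mul_le_mul_of_nonneg_left
          (Finset.le_sup' (fun φ => DcPred (P φ) Q - DcSet P G hG (P φ)) (Finset.mem_univ φ))
          (hπ.1 φ)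
    _ = S := by rw [← Finset.sum_mul, hπ.2, one_mul]

theorem continuousOn_DcPred_mixPred (hP : ∀ φ, IsModel (P φ)) (φ : F) :
    ContinuousOn (fun π => DcPred (P φ) (mixPred P π)) {π | IsPrior π} := by
  unfold DcPred
  refine continuousOn_finsetSum _ fun y _ => continuousOn_const.mul ?_
  have hmix : ContinuousOn (fun π => mixPred P π (Fin.init y) (y (Fin.last n)))
      {π | IsPrior π} := by
    unfold mixPred
    refine ContinuousOn.div (by fun_prop) (by fun_prop) fun π hπ => ?_
    exact (IsPrior.sum_mul_pos hπ fun φ => (hP φ).prefixProb_pos _).ne'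
  refine (continuousOn_const.div hmix fun π hπ => ?_).log fun π hπ => ?_
  · exact (IsPrior.mixPred_pos hπ hP _ _).ne'
  · exact (div_pos ((hP φ).condProb_pos y) (IsPrior.mixPred_pos hπ hP _ _)).ne'

theorem continuousOn_Jfun (hP : ∀ φ, IsModel (P φ)) (G : Finset F) (hG : G.Nonempty) :
    ContinuousOn (Jfun P G hG) {π | IsPrior π} := by
  rw [funext (Jfun_eq_sum G hG)]
  exact continuousOn_finsetSum _ fun φ _ => (continuous_apply φ).continuousOn.mul
    ((continuousOn_DcPred_mixPred hP φ).sub continuousOn_const)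

theorem exists_isMaxOn_Jfun [Nonempty F] (hP : ∀ φ, IsModel (P φ)) (G : Finset F)
    (hG : G.Nonempty) : ∃ π, IsPrior π ∧ ∀ ρ, IsPrior ρ → Jfun P G hG ρ ≤ Jfun P G hG π := by
  classical
  have hset : {π : F → ℝ | IsPrior π} = stdSimplex ℝ F := rfl
  have hcont := continuousOn_Jfun hP G hG
  rw [hset] at hcont
  obtain ⟨π, hπ, hmax⟩ := (isCompact_stdSimplex ℝ F).exists_isMaxOn
    ⟨_, single_mem_stdSimplex ℝ (Classical.arbitrary F)⟩ hcont
  exact ⟨π, hπ, fun ρ hρ => hmax hρ⟩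

/-- At a prior maximizing `J`, the worst-case regret of the mixture predictor is at most `J`. -/
theorem IsPrior.DcPred_sub_DcSet_le_Jfun {π : F → ℝ} (hπ : IsPrior π) (hP : ∀ φ, IsModel (P φ))
    (G : Finset F) (hG : G.Nonempty)
    (hmax : ∀ ρ, IsPrior ρ → Jfun P G hG ρ ≤ Jfun P G hG π) (φ : F) :
    DcPred (P φ) (mixPred P π) - DcSet P G hG (P φ) ≤ Jfun P G hG π := by
  classical
  let ρ : ℝ → F → ℝ := fun t => (1 - t) • π + t • Pi.single φ 1
  have hρ_prior {t : ℝ} (ht : t ∈ Set.Icc (0 : ℝ) 1) : IsPrior (ρ t) :=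
    convex_stdSimplex ℝ F hπ (single_mem_stdSimplex ℝ φ) (sub_nonneg.2 ht.2) ht.1 (by ring)
  have hρ_zero : ρ 0 = π := by simp [ρ]
  have hle {t : ℝ} (ht : t ∈ Set.Ioc (0 : ℝ) 1) :
      DcPred (P φ) (mixPred P (ρ t)) - DcSet P G hG (P φ) ≤ Jfun P G hG π := by
    have hprior := hρ_prior (Set.Ioc_subset_Icc_self ht)
    have hsplit : Jfun P G hG (ρ t) =
        (1 - t) * ∑ ψ, π ψ * (DcPred (P ψ) (mixPred P (ρ t)) - DcSet P G hG (P ψ)) +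
          t * (DcPred (P φ) (mixPred P (ρ t)) - DcSet P G hG (P φ)) := by
      rw [Jfun_eq_sum]
      generalize mixPred P (ρ t) = Q
      simp [ρ, add_mul, Finset.sum_add_distrib, Finset.mul_sum, mul_assoc, Pi.single_apply]
    have h₁ := mul_le_mul_of_nonneg_left
      (hπ.Jfun_le_sum hP G hG (hprior.isPredictor_mixPred hP)) (sub_nonneg.2 ht.2)
    have h₂ := hmax _ hprior
    refine le_of_mul_le_mul_left ?_ ht.1
    linarith
  have hcont : ContinuousOn
      (fun t => DcPred (P φ) (mixPred P (ρ t)) - DcSet P G hG (P φ)) (Set.Icc 0 1) :=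
    ((continuousOn_DcPred_mixPred hP φ).comp (by fun_prop) fun _ ht => hρ_prior ht).sub
      continuousOn_const
  have hlim := (hcont 0 (by simp)).mono_left (nhdsWithin_mono 0 Set.Ioc_subset_Icc_self)
  have hne : (nhdsWithin (0 : ℝ) (Set.Ioc 0 1)).NeBot := by
    rw [nhdsWithin_Ioc_eq_nhdsGT one_pos]
    infer_instance
  have := le_of_tendsto hlim (eventually_nhdsWithin_of_forall fun t ht => hle ht)
  simpa only [hρ_zero] using this

end RegretCapacity

variable {Y F : Type*} [Fintype Y] [Nonempty Y] [Fintype F] [Nonempty F] {n : ℕ}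

/-- Theorem 1: the min-max regret of universal batch learning under
the misspecification setting equals the maximum of `J` over priors. -/
theorem minmax_regret_eq_max_J
    (P : F → (Fin (n + 1) → Y) → ℝ) (hP : ∀ φ, IsModel (P φ))
    (G : Finset F) (hG : G.Nonempty) :
    IsGreatest {r : ℝ | ∃ π, IsPrior π ∧ r = Jfun P G hG π} (Rstar P G hG) := by
  obtain ⟨π, hπ, hmax⟩ := exists_isMaxOn_Jfun hP G hG
  have hleast : IsLeast {r : ℝ | ∃ Q, IsPredictor Q ∧
      r = Finset.univ.sup' Finset.univ_nonempty fun φ =>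
        G.sup' hG fun θ => regretN (P φ) (P θ) Q} (Jfun P G hG π) := by
    have hQ := hπ.isPredictor_mixPred hP
    refine ⟨⟨mixPred P π, hQ, le_antisymm (hπ.Jfun_le_sup' hP G hG hQ) ?_⟩, ?_⟩
    · refine Finset.sup'_le _ _ fun φ _ => ?_
      rw [sup'_regretN hP G hG hQ]
      exact hπ.DcPred_sub_DcSet_le_Jfun hP G hG hmax φ
    · rintro _ ⟨Q, hQ, rfl⟩
      exact hπ.Jfun_le_sup' hP G hG hQ
  have hR : Rstar P G hG = Jfun P G hG π := hleast.csInf_eq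
  rw [hR]
  refine ⟨⟨π, hπ, rfl⟩, ?_⟩
  rintro _ ⟨ρ, hρ, rfl⟩
  exact hmax ρ hρ
end
end

section
/- (Theorem 5, upper bound) Assume every hypothesis in Θ is an i.i.d. model: for each P_θ in Θ there is a strictly positive probability function p_θ on Y with P_θ(y^{N+L}) = Π_{n=1}^{N+L} p_θ(y_n). Then the combined batch-and-online min-max regret is bounded by the average of the one-step batch min-max regrets: R*_{N,L}(Θ, Φ) ≤ (1/L) Σ_{t=1}^{L} R*_{N+t}(Θ, Φ), where for each M with N+1 ≤ M ≤ N+L, R*_M(Θ, Φ) is the one-step min-max regret for predicting y_M given y^{M-1}, defined using the marginals of the models on Y^M: R*_M(Θ, Φ) = inf over one-step predictors Q (assigning to every y^{M-1} a strictly positive probability function on Y) of max_{φ in F} max_{P_θ in Θ} Σ_{y^M} P_φ(y^M) log( p_θ(y_M) / Q(y_M | y^{M-1}) ). -/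
/-!
Statement 11 (Theorem 5, upper bound): if every hypothesis in `Θ` is an i.i.d.
model, the combined batch-and-online min-max regret is bounded by the average
of the one-step batch min-max regrets:
`R*_{N,L}(Θ, Φ) ≤ (1/L) Σ_{t=1}^{L} R*_{N+t}(Θ, Φ)`.

Sequences of length `N + L` are encoded as functions `Fin (N + L) → Y`; for
`M ≤ N + L` the marginal on the first `M` coordinates is obtained by summing
out the remaining ones.
-/

noncomputable section

/-- Restriction of a sequence to its first `M` coordinates. -/
def restr {Y : Type*} {K M : ℕ} (h : M ≤ K) (y : Fin K → Y) : Fin M → Y :=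
  fun i => y (Fin.castLE h i)

/-- Marginal of `P` on the first `M` coordinates. -/
def margTo {Y : Type*} [Fintype Y] [DecidableEq Y] {K : ℕ}
    (P : (Fin K → Y) → ℝ) (M : ℕ) (h : M ≤ K) (u : Fin M → Y) : ℝ :=
  ∑ y : Fin K → Y, if restr h y = u then P y else 0

/-- The last `L` coordinates of a sequence of length `N + L`. -/
def lastL {Y : Type*} {N L : ℕ} (y : Fin (N + L) → Y) : Fin L → Y :=
  fun j => y (Fin.natAdd N j)

/-- A model: a strictly positive probability function on `Y^(N+L)`. -/
def IsModelFull {Y : Type*} [Fintype Y] {K : ℕ} (P : (Fin K → Y) → ℝ) : Prop :=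
  (∀ y, 0 < P y) ∧ (∑ y, P y) = 1

/-- An `L`-predictor: to every `y^N` it assigns a strictly positive probability
function on `Y^L`. -/
def IsLPredictor {Y : Type*} [Fintype Y] {N L : ℕ}
    (Q : (Fin N → Y) → (Fin L → Y) → ℝ) : Prop :=
  ∀ z, (∀ w, 0 < Q z w) ∧ (∑ w, Q z w) = 1

/-- A one-step predictor: to every `y^{M-1}` it assigns a strictly positive
probability function on `Y`. -/
def IsOneStepPredictor {Y : Type*} [Fintype Y] {m : ℕ}
    (q : (Fin m → Y) → Y → ℝ) : Prop :=
  ∀ u, (∀ y, 0 < q u y) ∧ (∑ y, q u y) = 1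

/-- Conditional probability `P(y^L | y^N) = P(y^{N+L}) / P(y^N)`. -/
def condFull {Y : Type*} [Fintype Y] [DecidableEq Y] {N L : ℕ}
    (P : (Fin (N + L) → Y) → ℝ) (y : Fin (N + L) → Y) : ℝ :=
  P y / margTo P N (Nat.le_add_right N L) (restr (Nat.le_add_right N L) y)

/-- The normalized block regret
`(1/L) Σ_{y^{N+L}} P_φ(y^{N+L}) log( P_θ(y^L|y^N) / Q(y^L|y^N) )`. -/
def regretFull {Y : Type*} [Fintype Y] [DecidableEq Y] {N L : ℕ}
    (Pφ Pθ : (Fin (N + L) → Y) → ℝ)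
    (Q : (Fin N → Y) → (Fin L → Y) → ℝ) : ℝ :=
  (1 / (L : ℝ)) * ∑ y, Pφ y *
    Real.log (condFull Pθ y / Q (restr (Nat.le_add_right N L) y) (lastL y))

/-- The combined min-max regret `R*_{N,L}(Θ, Φ)`. -/
def RstarFull {Y F : Type*} [Fintype Y] [DecidableEq Y] [Fintype F] [Nonempty F]
    {N L : ℕ} (P : F → (Fin (N + L) → Y) → ℝ) (G : Finset F) (hG : G.Nonempty) : ℝ :=
  sInf {r : ℝ | ∃ Q, IsLPredictor Q ∧
    r = Finset.univ.sup' Finset.univ_nonempty fun φ =>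
          G.sup' hG fun θ => regretFull (P φ) (P θ) Q}

/-- The one-step min-max regret `R*_{N+t+1}(Θ, Φ)` (for `t : Fin L`, predicting
`y_{N+t+1}` given `y^{N+t}`), defined using the marginals of the models on the
first `N+t+1` coordinates and the i.i.d. single-letter hypotheses `p θ`. -/
def RstarStep {Y F : Type*} [Fintype Y] [DecidableEq Y] [Fintype F] [Nonempty F]
    {N L : ℕ} (P : F → (Fin (N + L) → Y) → ℝ) (G : Finset F) (hG : G.Nonempty)
    (p : F → Y → ℝ) (t : Fin L) : ℝ :=
  sInf {r : ℝ | ∃ q : (Fin (N + (t : ℕ)) → Y) → Y → ℝ, IsOneStepPredictor q ∧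
    r = Finset.univ.sup' Finset.univ_nonempty fun φ =>
          G.sup' hG fun θ =>
            ∑ u : Fin (N + (t : ℕ) + 1) → Y,
              margTo (P φ) (N + (t : ℕ) + 1) (Nat.add_le_add_left t.2 N) u *
                Real.log (p θ (u (Fin.last (N + (t : ℕ)))) /
                  q (Fin.init u) (u (Fin.last (N + (t : ℕ)))))}

@[simp]
theorem restr_append {Y : Type*} {N L : ℕ} (a : Fin N → Y) (b : Fin L → Y) :
    restr (Nat.le_add_right N L) (Fin.append a b) = a := by
  funext i
  exact Fin.append_left a b i

@[simp]
theorem lastL_append {Y : Type*} {N L : ℕ} (a : Fin N → Y) (b : Fin L → Y) :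
    lastL (Fin.append a b) = b := by
  funext i
  exact Fin.append_right a b i

theorem append_restr_lastL {Y : Type*} {N L : ℕ} (y : Fin (N + L) → Y) :
    Fin.append (restr (Nat.le_add_right N L) y) (lastL y) = y :=
  Fin.append_castAdd_natAdd

theorem sum_eq_sum_append {Y : Type*} [Fintype Y] {N L : ℕ} (f : (Fin (N + L) → Y) → ℝ) :
    ∑ y, f y = ∑ a : Fin N → Y, ∑ b : Fin L → Y, f (Fin.append a b) := by
  rw [← Fintype.sum_prod_type', ← (Fin.appendEquiv N L).sum_comp f]
  rfl

theorem margTo_eq_sum_append {Y : Type*} [Fintype Y] [DecidableEq Y] {N L : ℕ}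
    (P : (Fin (N + L) → Y) → ℝ) (a : Fin N → Y) :
    margTo P N (Nat.le_add_right N L) a = ∑ b : Fin L → Y, P (Fin.append a b) := by
  rw [margTo, sum_eq_sum_append, Finset.sum_eq_single a]
  · simp
  · intro a' _ h
    simp [h]
  · simp

theorem sum_margTo_mul {Y : Type*} [Fintype Y] [DecidableEq Y] {K M : ℕ}
    (P : (Fin K → Y) → ℝ) (h : M ≤ K) (f : (Fin M → Y) → ℝ) :
    ∑ u, margTo P M h u * f u = ∑ y, P y * f (restr h y) := by
  simp_rw [margTo, Finset.sum_mul]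
  rw [Finset.sum_comm]
  simp [ite_mul]

theorem sum_prod_eq_one {Y : Type*} [Fintype Y] {L : ℕ} {p : Y → ℝ} (hp : ∑ y, p y = 1) :
    ∑ b : Fin L → Y, ∏ j, p (b j) = 1 := by
  classical
  have h := Finset.prod_univ_sum (fun _ : Fin L => (Finset.univ : Finset Y)) fun _ y => p y
  simpa [hp] using h.symm

theorem condFull_of_iid {Y : Type*} [Fintype Y] [DecidableEq Y] {N L : ℕ}
    {P : (Fin (N + L) → Y) → ℝ} {p : Y → ℝ} (hpos : ∀ y, 0 < p y) (hsum : ∑ y, p y = 1)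
    (hP : ∀ y, P y = ∏ i, p (y i)) (y : Fin (N + L) → Y) :
    condFull P y = ∏ j : Fin L, p (lastL y j) := by
  have hne : ∏ i : Fin N, p (restr (Nat.le_add_right N L) y i) ≠ 0 :=
    (Finset.prod_pos fun i _ => hpos _).ne'
  have hmarg : margTo P N (Nat.le_add_right N L) (restr (Nat.le_add_right N L) y) =
      ∏ i : Fin N, p (restr (Nat.le_add_right N L) y i) := by
    simp_rw [margTo_eq_sum_append, hP, Fin.prod_univ_add, Fin.append_left, Fin.append_right]
    rw [← Finset.mul_sum, sum_prod_eq_one hsum, mul_one]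
  rw [condFull, hmarg, hP, Fin.prod_univ_add, div_eq_iff hne, mul_comm]
  rfl

/-- The block predictor obtained by chaining one-step predictors. -/
def chainPredictor {Y : Type*} {N L : ℕ} (q : (t : Fin L) → (Fin (N + (t : ℕ)) → Y) → Y → ℝ)
    (z : Fin N → Y) (w : Fin L → Y) : ℝ :=
  ∏ t : Fin L, q t (restr (Nat.add_le_add_left t.2.le N) (Fin.append z w)) (w t)

theorem restr_append_snoc {Y : Type*} {N L M : ℕ} (h : M ≤ N + L) (h' : M ≤ N + (L + 1))
    (z : Fin N → Y) (w : Fin L → Y) (x : Y) :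
    restr h' (Fin.append z (Fin.snoc w x : Fin (L + 1) → Y)) = restr h (Fin.append z w) := by
  funext i
  rw [Fin.append_snoc]
  exact Fin.snoc_castSucc (α := fun _ => Y) x (Fin.append z w) (Fin.castLE h i)

theorem sum_chainPredictor {Y : Type*} [Fintype Y] {N L : ℕ}
    (q : (t : Fin L) → (Fin (N + (t : ℕ)) → Y) → Y → ℝ) (hq : ∀ t u, ∑ y, q t u y = 1)
    (z : Fin N → Y) : ∑ w, chainPredictor q z w = 1 := by
  induction L with
  | zero => simp [chainPredictor]
  | succ L ih =>
    rw [← (Fin.snocEquiv fun _ : Fin (L + 1) => Y).sum_comp, Fintype.sum_prod_type_right]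
    refine Eq.trans (Finset.sum_congr rfl fun w _ => ?_)
      (ih (fun t => q t.castSucc) fun t => hq t.castSucc)
    have key (x : Y) : chainPredictor q z (Fin.snocEquiv (fun _ : Fin (L + 1) => Y) (x, w)) =
        chainPredictor (fun t : Fin L => q t.castSucc) z w *
          q (Fin.last L) (Fin.append z w) x := by
      change chainPredictor q z (Fin.snoc w x : Fin (L + 1) → Y) = _
      rw [chainPredictor, Fin.prod_univ_castSucc]
      congr 1
      · refine Finset.prod_congr rfl fun t _ => ?_
        rw [Fin.snoc_castSucc]
        congr 1
        exact restr_append_snoc (Nat.add_le_add_left t.2.le N) _ z w x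
      · rw [Fin.snoc_last]
        congr 1
        exact restr_append_snoc le_rfl _ z w x
    simp_rw [key]
    rw [← Finset.mul_sum, hq (Fin.last L), mul_one]

theorem isLPredictor_chainPredictor {Y : Type*} [Fintype Y] {N L : ℕ}
    {q : (t : Fin L) → (Fin (N + (t : ℕ)) → Y) → Y → ℝ} (hq : ∀ t, IsOneStepPredictor (q t)) :
    IsLPredictor (chainPredictor q) := fun z =>
  ⟨fun _ => Finset.prod_pos fun t _ => (hq t _).1 _,
    sum_chainPredictor q (fun t u => (hq t u).2) z⟩

theorem regretFull_chainPredictor {Y : Type*} [Fintype Y] [DecidableEq Y] {N L : ℕ}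
    (Pφ : (Fin (N + L) → Y) → ℝ) {Pθ : (Fin (N + L) → Y) → ℝ} {p : Y → ℝ}
    (hpos : ∀ y, 0 < p y) (hsum : ∑ y, p y = 1) (hiid : ∀ y, Pθ y = ∏ i, p (y i))
    {q : (t : Fin L) → (Fin (N + (t : ℕ)) → Y) → Y → ℝ} (hq : ∀ t, IsOneStepPredictor (q t)) :
    regretFull Pφ Pθ (chainPredictor q) = (1 / (L : ℝ)) * ∑ t : Fin L,
      ∑ u : Fin (N + (t : ℕ) + 1) → Y,
        margTo Pφ (N + (t : ℕ) + 1) (Nat.add_le_add_left t.2 N) u *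
          Real.log (p (u (Fin.last (N + (t : ℕ)))) /
            q t (Fin.init u) (u (Fin.last (N + (t : ℕ))))) := by
  simp_rw [sum_margTo_mul, regretFull]
  rw [Finset.sum_comm]
  congr 1
  refine Finset.sum_congr rfl fun y _ => ?_
  rw [← Finset.mul_sum, condFull_of_iid hpos hsum hiid, chainPredictor, append_restr_lastL,
    ← Finset.prod_div_distrib,
    Real.log_prod fun t _ => (div_pos (hpos _) ((hq t _).1 _)).ne']
  rfl

theorem margTo_pos {Y : Type*} [Fintype Y] [Nonempty Y] [DecidableEq Y] {N L : ℕ}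
    {P : (Fin (N + L) → Y) → ℝ} (hP : ∀ y, 0 < P y) (a : Fin N → Y) :
    0 < margTo P N (Nat.le_add_right N L) a := by
  rw [margTo_eq_sum_append]
  exact Finset.sum_pos (fun _ _ => hP _) Finset.univ_nonempty

theorem regretFull_self_nonneg {Y : Type*} [Fintype Y] [Nonempty Y] [DecidableEq Y] {N L : ℕ}
    {P : (Fin (N + L) → Y) → ℝ} (hP : IsModelFull P)
    {Q : (Fin N → Y) → (Fin L → Y) → ℝ} (hQ : IsLPredictor Q) :
    0 ≤ regretFull P P Q := by
  refine mul_nonneg (by positivity) ?_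
  have hbound (y : Fin (N + L) → Y) :
      P y - margTo P N (Nat.le_add_right N L) (restr (Nat.le_add_right N L) y) *
          Q (restr (Nat.le_add_right N L) y) (lastL y) ≤
        P y * Real.log (condFull P y / Q (restr (Nat.le_add_right N L) y) (lastL y)) := by
    have hPy := hP.1 y
    have hm := margTo_pos hP.1 (restr (Nat.le_add_right N L) y)
    have hQy := (hQ (restr (Nat.le_add_right N L) y)).1 (lastL y)
    have hx : 0 < condFull P y / Q (restr (Nat.le_add_right N L) y) (lastL y) :=
      div_pos (div_pos hPy hm) hQy
    refine le_trans (le_of_eq ?_)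
      (mul_le_mul_of_nonneg_left (Real.one_sub_inv_le_log_of_pos hx) hPy.le)
    rw [condFull]
    field_simp
  refine le_trans (le_of_eq ?_) (Finset.sum_le_sum fun y _ => hbound y)
  rw [Finset.sum_sub_distrib, sum_eq_sum_append, sum_eq_sum_append]
  simp_rw [restr_append, lastL_append, ← Finset.mul_sum, (hQ _).2, margTo_eq_sum_append]
  simp

theorem exists_isOneStepPredictor (Y : Type*) [Fintype Y] [Nonempty Y] (m : ℕ) :
    ∃ q : (Fin m → Y) → Y → ℝ, IsOneStepPredictor q :=
  ⟨fun _ _ => (Fintype.card Y : ℝ)⁻¹, fun _ =>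
    ⟨fun _ => inv_pos.mpr (Nat.cast_pos.mpr Fintype.card_pos), by simp⟩⟩

/-- Theorem 5, upper bound. -/
theorem combined_regret_le_avg_one_step
    {Y F : Type*} [Fintype Y] [Nonempty Y] [DecidableEq Y]
    [Fintype F] [Nonempty F] {N L : ℕ} (hL : 0 < L)
    (P : F → (Fin (N + L) → Y) → ℝ) (hP : ∀ φ, IsModelFull (P φ))
    (G : Finset F) (hG : G.Nonempty)
    (p : F → Y → ℝ)
    (hp : ∀ θ ∈ G, (∀ y, 0 < p θ y) ∧ (∑ y, p θ y) = 1)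
    (hiid : ∀ θ ∈ G, ∀ y : Fin (N + L) → Y, P θ y = ∏ i, p θ (y i)) :
    RstarFull P G hG ≤ (1 / (L : ℝ)) * ∑ t : Fin L, RstarStep P G hG p t := by
  refine le_of_forall_pos_le_add fun ε hε => ?_
  have hstep (t : Fin L) : ∃ q : (Fin (N + (t : ℕ)) → Y) → Y → ℝ, IsOneStepPredictor q ∧
      ∀ φ, ∀ θ ∈ G, ∑ u : Fin (N + (t : ℕ) + 1) → Y,
        margTo (P φ) (N + (t : ℕ) + 1) (Nat.add_le_add_left t.2 N) u *
          Real.log (p θ (u (Fin.last (N + (t : ℕ)))) /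
            q (Fin.init u) (u (Fin.last (N + (t : ℕ))))) ≤ RstarStep P G hG p t + ε := by
    obtain ⟨q₀, hq₀⟩ := exists_isOneStepPredictor Y (N + (t : ℕ))
    obtain ⟨_, hr⟩ : ∃ r, _ ∧ r < RstarStep P G hG p t + ε := by
      rw [RstarStep]
      refine Real.lt_sInf_add_pos ?_ hε
      exact ⟨_, q₀, hq₀, rfl⟩
    obtain ⟨⟨q, hq, rfl⟩, hr⟩ := hr
    refine ⟨q, hq, fun φ θ hθ => le_trans ?_ hr.le⟩
    exact (Finset.le_sup' (f := fun θ => ∑ u : Fin (N + (t : ℕ) + 1) → Y,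
      margTo (P φ) (N + (t : ℕ) + 1) (Nat.add_le_add_left t.2 N) u *
        Real.log (p θ (u (Fin.last (N + (t : ℕ)))) /
          q (Fin.init u) (u (Fin.last (N + (t : ℕ)))))) hθ).trans
      (Finset.le_sup' (f := fun φ => G.sup' hG fun θ => ∑ u : Fin (N + (t : ℕ) + 1) → Y,
        margTo (P φ) (N + (t : ℕ) + 1) (Nat.add_le_add_left t.2 N) u *
          Real.log (p θ (u (Fin.last (N + (t : ℕ)))) /
            q (Fin.init u) (u (Fin.last (N + (t : ℕ)))))) (Finset.mem_univ φ))
  choose q hq hqle using hstep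
  have hbdd : BddBelow {r : ℝ | ∃ Q, IsLPredictor Q ∧
      r = Finset.univ.sup' Finset.univ_nonempty fun φ =>
        G.sup' hG fun θ => regretFull (P φ) (P θ) Q} := by
    refine ⟨0, ?_⟩
    rintro _ ⟨Q, hQ, rfl⟩
    obtain ⟨θ, hθ⟩ := hG
    exact (regretFull_self_nonneg (hP θ) hQ).trans
      ((Finset.le_sup' (f := fun θ' => regretFull (P θ) (P θ') Q) hθ).trans
        (Finset.le_sup' (f := fun φ => G.sup' ⟨θ, hθ⟩ fun θ' => regretFull (P φ) (P θ') Q)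
          (Finset.mem_univ θ)))
  refine (csInf_le hbdd ⟨_, isLPredictor_chainPredictor hq, rfl⟩).trans ?_
  refine Finset.sup'_le _ _ fun φ _ => Finset.sup'_le _ _ fun θ hθ => ?_
  rw [regretFull_chainPredictor (P φ) (hp θ hθ).1 (hp θ hθ).2 (hiid θ hθ) hq]
  calc _ ≤ (1 / (L : ℝ)) * ∑ t : Fin L, (RstarStep P G hG p t + ε) :=
        mul_le_mul_of_nonneg_left (Finset.sum_le_sum fun t _ => hqle t φ θ hθ) (by positivity)
    _ = _ := by
        have hL' : (L : ℝ) ≠ 0 := Nat.cast_ne_zero.mpr hL.ne'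
        rw [Finset.sum_add_distrib, mul_add]
        simp [hL']
end
end
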